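/- If g and h are independent standard real Gaussian random variables (each distributed N(0,1)), then E[ sign(g^2 − h^2) · g^2 ] = 2/π. -/

import Mathlib

open MeasureTheory ProbabilityTheory Real

lemma aux_measurable_sign : Measurable Real.sign := by
  unfold Real.sign
  exact Measurable.ite measurableSet_Iio measurable_const
    (Measurable.ite measurableSet_Ioi measurable_const measurable_const)

lemma aux_abs_sign_le (x : ℝ) : |Real.sign x| ≤ 1 := by
  rcases Real.sign_apply_eq x with h | h | h <;> simp [h]

lemma aux_intervalIntegrable (a b : ℝ) : IntervalIntegrable
    (fun t : ℝ => Real.sign (cos t ^ 2 - sin t ^ 2) * cos t ^ 2) volume a b := by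
  have hm : Measurable (fun t : ℝ => Real.sign (cos t ^ 2 - sin t ^ 2) * cos t ^ 2) :=
    (aux_measurable_sign.comp (by fun_prop)).mul (by fun_prop)
  refine (intervalIntegrable_const (c := (1 : ℝ))).mono_fun hm.aestronglyMeasurable ?_
  refine Filter.Eventually.of_forall fun t => ?_
  simp only [norm_mul, Real.norm_eq_abs, norm_one, abs_pow, sq_abs]
  have h1 := aux_abs_sign_le (cos t ^ 2 - sin t ^ 2)
  have h2 := cos_sq_le_one t
  exact mul_le_one₀ h1 (sq_nonneg _) h2

lemma aux_period (t : ℝ) :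
    ∫ x in t..t + π, Real.sign (cos x ^ 2 - sin x ^ 2) * cos x ^ 2 = 1 := by
  have hp : Function.Periodic
      (fun t : ℝ => Real.sign (cos t ^ 2 - sin t ^ 2) * cos t ^ 2) π := by
    intro x; simp
  rw [hp.intervalIntegral_add_eq t (-(π / 4)),
    ← intervalIntegral.integral_add_adjacent_intervals (b := π / 4)
      (aux_intervalIntegrable _ _) (aux_intervalIntegrable _ _)]
  have hpi := Real.pi_pos
  have h1 : ∫ x in (-(π / 4))..(π / 4), Real.sign (cos x ^ 2 - sin x ^ 2) * cos x ^ 2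
      = ∫ x in (-(π / 4))..(π / 4), cos x ^ 2 := by
    refine intervalIntegral.integral_congr_uIoo fun x hx => ?_
    rw [Set.uIoo_of_le (by linarith)] at hx
    have : 0 < cos x ^ 2 - sin x ^ 2 := by
      rw [← cos_two_mul']
      exact cos_pos_of_mem_Ioo ⟨by linarith [hx.1], by linarith [hx.2]⟩
    simp [Real.sign_of_pos this]
  have h2 : ∫ x in (π / 4)..(-(π / 4) + π), Real.sign (cos x ^ 2 - sin x ^ 2) * cos x ^ 2
      = ∫ x in (π / 4)..(-(π / 4) + π), -cos x ^ 2 := by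
    refine intervalIntegral.integral_congr_uIoo fun x hx => ?_
    rw [Set.uIoo_of_le (by linarith)] at hx
    have : cos x ^ 2 - sin x ^ 2 < 0 := by
      rw [← cos_two_mul']
      exact cos_neg_of_pi_div_two_lt_of_lt (by linarith [hx.1]) (by linarith [hx.2])
    simp [Real.sign_of_neg this]
  rw [h1, h2, intervalIntegral.integral_neg, integral_cos_sq, integral_cos_sq]
  have e : -(π / 4) + π = π - π / 4 := by ring
  rw [e, cos_pi_sub, sin_pi_sub, cos_neg, sin_neg]
  have : cos (π / 4) * sin (π / 4) = 1 / 2 := by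
    have := sin_two_mul (π / 4)
    rw [show 2 * (π / 4) = π / 2 by ring, sin_pi_div_two] at this
    linarith
  linarith

lemma aux_angular :
    ∫ x in Set.Ioo (-π) π, Real.sign (cos x ^ 2 - sin x ^ 2) * cos x ^ 2 = 2 := by
  have hpi := Real.pi_pos
  rw [← integral_Ioc_eq_integral_Ioo, ← intervalIntegral.integral_of_le (by linarith),
    ← intervalIntegral.integral_add_adjacent_intervals (b := 0)
      (aux_intervalIntegrable _ _) (aux_intervalIntegrable _ _)]
  have h1 := aux_period (-π)
  have h2 := aux_period 0
  rw [neg_add_cancel] at h1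
  rw [zero_add] at h2
  rw [h1, h2]; norm_num

lemma aux_radial :
    ∫ r in Set.Ioi (0 : ℝ), r ^ 3 * ((2 * π)⁻¹ * exp (-(r ^ 2) / 2)) = 1 / π := by
  have h := integral_rpow_mul_exp_neg_mul_rpow (p := 2) (q := 3) (b := 1 / 2)
    (by norm_num) (by norm_num) (by norm_num)
  have e : ∀ r : ℝ, r ^ 3 * ((2 * π)⁻¹ * exp (-(r ^ 2) / 2))
      = (2 * π)⁻¹ * (r ^ (3 : ℝ) * exp (-(1 / 2) * r ^ (2 : ℝ))) := by
    intro r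
    have e1 : r ^ (3 : ℝ) = r ^ 3 := by exact_mod_cast Real.rpow_natCast r 3
    have e2 : r ^ (2 : ℝ) = r ^ 2 := by exact_mod_cast Real.rpow_natCast r 2
    rw [e1, e2, show -(r ^ 2) / 2 = -(1 / 2) * r ^ 2 by ring]
    ring
  simp_rw [e]
  rw [integral_const_mul, h]
  have e3 : (-(3 + 1) / 2 : ℝ) = -((2 : ℕ) : ℝ) := by norm_num
  have e4 : ((3 + 1) / 2 : ℝ) = 2 := by norm_num
  rw [e3, e4, Real.rpow_neg (by norm_num), Real.rpow_natCast, Real.Gamma_two]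
  have := Real.pi_ne_zero
  field_simp

/-- If `g` and `h` are independent standard real Gaussian random variables,
then `E[sign(g² − h²) · g²] = 2/π`. -/
theorem sign_diff_sq_mul_sq_gaussian_expectation
    {Ω : Type*} [MeasureSpace Ω] [IsProbabilityMeasure (ℙ : Measure Ω)]
    (g h : Ω → ℝ)
    (hgh : IndepFun g h ℙ)
    (hg : Measure.map g ℙ = gaussianReal 0 1)
    (hh : Measure.map h ℙ = gaussianReal 0 1) :
    ∫ ω, Real.sign (g ω ^ 2 - h ω ^ 2) * g ω ^ 2 ∂ℙ = 2 / π := by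
  have hgm : AEMeasurable g ℙ := aemeasurable_of_map_neZero (by rw [hg]; infer_instance)
  have hhm : AEMeasurable h ℙ := aemeasurable_of_map_neZero (by rw [hh]; infer_instance)
  have hmap := hgh.map_prod_eq_prod_map_map hgm hhm
  have hF : Measurable (fun p : ℝ × ℝ => Real.sign (p.1 ^ 2 - p.2 ^ 2) * p.1 ^ 2) :=
    (aux_measurable_sign.comp (by fun_prop)).mul (by fun_prop)
  have h1 := integral_map (hgm.prodMk hhm) hF.aestronglyMeasurable
  simp only at h1
  rw [← h1, hmap, hg, hh, gaussianReal_of_var_ne_zero 0 one_ne_zero,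
    prod_withDensity (measurable_gaussianPDF _ _) (measurable_gaussianPDF _ _),
    integral_withDensity_eq_integral_toReal_smul
      (f := fun z : ℝ × ℝ => gaussianPDF 0 1 z.1 * gaussianPDF 0 1 z.2)
      (((measurable_gaussianPDF _ _).comp measurable_fst).mul
        ((measurable_gaussianPDF _ _).comp measurable_snd))
      (Filter.Eventually.of_forall fun x =>
        ENNReal.mul_lt_top gaussianPDF_lt_top gaussianPDF_lt_top),
    ← Measure.volume_eq_prod, ← integral_comp_polarCoord_symm, polarCoord_target]
  have key : ∀ p ∈ Set.Ioi (0 : ℝ) ×ˢ Set.Ioo (-π) π,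
      p.1 • ((gaussianPDF 0 1 (polarCoord.symm p).1 * gaussianPDF 0 1 (polarCoord.symm p).2).toReal
        • (Real.sign ((polarCoord.symm p).1 ^ 2 - (polarCoord.symm p).2 ^ 2)
          * (polarCoord.symm p).1 ^ 2))
      = (p.1 ^ 3 * ((2 * π)⁻¹ * exp (-(p.1 ^ 2) / 2)))
        * (Real.sign (cos p.2 ^ 2 - sin p.2 ^ 2) * cos p.2 ^ 2) := by
    rintro ⟨r, t⟩ ⟨hr, -⟩
    have hr : 0 < r := hr
    have hs : Real.sign ((r * cos t) ^ 2 - (r * sin t) ^ 2)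
        = Real.sign (cos t ^ 2 - sin t ^ 2) := by
      rw [show (r * cos t) ^ 2 - (r * sin t) ^ 2 = r ^ 2 * (cos t ^ 2 - sin t ^ 2) by ring]
      have h2 : 0 < r ^ 2 := by positivity
      rcases lt_trichotomy (cos t ^ 2 - sin t ^ 2) 0 with h | h | h
      · rw [Real.sign_of_neg h, Real.sign_of_neg (mul_neg_of_pos_of_neg h2 h)]
      · rw [h, mul_zero]
      · rw [Real.sign_of_pos h, Real.sign_of_pos (mul_pos h2 h)]
    have hd : gaussianPDFReal 0 1 (r * cos t) * gaussianPDFReal 0 1 (r * sin t)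
        = (2 * π)⁻¹ * exp (-(r ^ 2) / 2) := by
      simp only [gaussianPDFReal_def, NNReal.coe_one, mul_one, sub_zero]
      rw [mul_mul_mul_comm, ← mul_inv, Real.mul_self_sqrt (by positivity), ← Real.exp_add]
      congr 2
      linear_combination (-(r ^ 2) / 2) * sin_sq_add_cos_sq t
    simp only [polarCoord_symm_apply, ENNReal.toReal_mul, toReal_gaussianPDF, smul_eq_mul]
    rw [hs, hd]
    ring
  rw [setIntegral_congr_fun (measurableSet_Ioi.prod measurableSet_Ioo) key,
    Measure.volume_eq_prod,
    setIntegral_prod_mul (fun r : ℝ => r ^ 3 * ((2 * π)⁻¹ * exp (-(r ^ 2) / 2)))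
      (fun t : ℝ => Real.sign (cos t ^ 2 - sin t ^ 2) * cos t ^ 2), aux_radial, aux_angular]
  ring
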